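/- For all real numbers λ_p > 0 and V > V_o > 0, the quantity 2β(V) = 2·(V_o·exp(−λ_p·V) − V·exp(−λ_p·V_o) + V − V_o)/(λ_p²·(V − V_o)·V·V_o) satisfies 0 < 2β(V) < 1. -/

import Mathlib

lemma aux_convex : StrictConvexOn ℝ (Set.Ici (0:ℝ)) (fun x : ℝ => x ^ 2 / 2 - Real.exp (-x)) := by
  have hd : ∀ x : ℝ, HasDerivAt (fun x : ℝ => x ^ 2 / 2 - Real.exp (-x)) (x + Real.exp (-x)) x := by
    intro x
    have h1 := ((hasDerivAt_id x).pow 2).div_const 2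
    have h2 := (hasDerivAt_neg x).exp
    have h3 := h1.sub h2
    refine HasDerivAt.congr_deriv h3 ?_
    simp
  refine StrictMonoOn.strictConvexOn_of_deriv (convex_Ici 0) (by fun_prop) ?_
  intro x hx y hy hxy
  rw [(hd x).deriv, (hd y).deriv]
  rw [interior_Ici, Set.mem_Ioi] at hx
  have h1 : Real.exp (-y) = Real.exp (-x) * Real.exp (-(y - x)) := by
    rw [← Real.exp_add]; congr 1; ring
  have h2 : -(y - x) + 1 < Real.exp (-(y - x)) := Real.add_one_lt_exp (by linarith)
  have h3 : Real.exp (-x) ≤ 1 := Real.exp_le_one_iff.2 (by linarith)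
  have h4 := Real.exp_pos (-x)
  rw [h1]
  nlinarith [mul_lt_mul_of_pos_left h2 h4]

lemma aux_bounds (a b : ℝ) (ha : 0 < a) (hab : a < b) :
    0 < a * Real.exp (-b) - b * Real.exp (-a) + b - a ∧
    2 * (a * Real.exp (-b) - b * Real.exp (-a) + b - a) < (b - a) * b * a := by
  have hb : 0 < b := ha.trans hab
  have hw : 0 < 1 - a / b := by rw [sub_pos, div_lt_one hb]; exact hab
  have hq : 0 < a / b := by positivity
  have hba : b * (a / b) = a := by field_simp
  constructor
  · have h := strictConvexOn_exp.2 (Set.mem_univ 0) (Set.mem_univ (-b)) (by linarith) hw hq (by ring)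
    simp only [smul_eq_mul, Real.exp_zero] at h
    rw [show (1 - a / b) * 0 + a / b * -b = -a by linarith] at h
    have h5 := mul_lt_mul_of_pos_left h hb
    rw [show b * ((1 - a / b) * 1 + a / b * Real.exp (-b))
      = b - b * (a / b) + b * (a / b) * Real.exp (-b) by ring, hba] at h5
    linarith
  · have h := aux_convex.2 (Set.mem_Ici.2 le_rfl) (Set.mem_Ici.2 hb.le) hb.ne hw hq (by ring)
    simp only [smul_eq_mul, neg_zero, Real.exp_zero] at h
    rw [show (1 - a / b) * 0 + a / b * b = a by linarith] at h
    have h5 := mul_lt_mul_of_pos_left h hb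
    rw [show b * ((1 - a / b) * (0 ^ 2 / 2 - 1) + a / b * (b ^ 2 / 2 - Real.exp (-b)))
      = -b + b * (a / b) + b * (a / b) * (b ^ 2 / 2 - Real.exp (-b)) by ring, hba] at h5
    linarith

/-- For all `λ_p > 0` and `V > V_o > 0`, the retention probability `2β(V)` lies strictly
between `0` and `1`. -/
theorem two_beta_prob (lam_p V V_o : ℝ) (hlam : 0 < lam_p) (hVo : 0 < V_o) (hV : V_o < V) :
    0 < 2 * ((V_o * Real.exp (-lam_p * V) - V * Real.exp (-lam_p * V_o) + V - V_o)
        / (lam_p ^ 2 * (V - V_o) * V * V_o)) ∧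
    2 * ((V_o * Real.exp (-lam_p * V) - V * Real.exp (-lam_p * V_o) + V - V_o)
        / (lam_p ^ 2 * (V - V_o) * V * V_o)) < 1 := by
  obtain ⟨h1, h2⟩ := aux_bounds (lam_p * V_o) (lam_p * V) (by positivity)
    (mul_lt_mul_of_pos_left hV hlam)
  have hD : 0 < lam_p ^ 2 * (V - V_o) * V * V_o := by
    have : 0 < V - V_o := sub_pos.2 hV
    have : 0 < V := hVo.trans hV
    positivity
  simp only [neg_mul]
  constructor
  · refine mul_pos two_pos (div_pos ?_ hD)
    refine pos_of_mul_pos_right (a := lam_p) ?_ hlam.le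
    linarith
  · rw [← mul_div_assoc, div_lt_one hD]
    refine lt_of_mul_lt_mul_left (a := lam_p) ?_ hlam.le
    linarith
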